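/- arXiv:1602.01981 — 3 statements merged into one kernel-verified Lean document; each statement's English description precedes it below -/
import Mathlib

section
/- Let (R, m, k) be a commutative Noetherian local ring, I_1,...,I_t ideals, M, N finitely generated R-modules, N' ⊆ N a submodule, and fix i ≥ 0. Set W_n = Ext_R^i(M, N/(I_1^{n_1}⋯I_t^{n_t})N') for n ∈ ℕ^t. Then either Hom_R(k, W_n) = 0 for all sufficiently large n, or Hom_R(k, W_n) ≠ 0 for all sufficiently large n. -/
open CategoryTheory

namespace FGModuleCat
universe u
variable {R : Type u} [CommRing R]

lemma exists_epi_of_free (X : FGModuleCat.{u} R) :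
    ∃ (n : ℕ) (e : FGModuleCat.of R (Fin n → R) ⟶ X), Function.Surjective e.hom.hom := by
  obtain ⟨n, f, hf⟩ := Module.Finite.exists_fin' R X.obj
  exact ⟨n, ObjectProperty.homMk (ModuleCat.ofHom f), hf⟩

lemma epi_of_surjective {X Y : FGModuleCat.{u} R} (f : X ⟶ Y)
    (hf : Function.Surjective f.hom.hom) : Epi f :=
  (forget₂ (FGModuleCat R) (ModuleCat R)).epi_of_epi_map ((ModuleCat.epi_iff_surjective _).2 hf)

instance projective_of_free (n : ℕ) [IsNoetherianRing R] :
    Projective (FGModuleCat.of R (Fin n → R)) := by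
  constructor
  intro E Y a b _
  have hb : Epi b.hom := inferInstanceAs (Epi ((forget₂ (FGModuleCat R) (ModuleCat R)).map b))
  have : Projective (ModuleCat.of R (Fin n → R)) := inferInstance
  refine ⟨ObjectProperty.homMk (Projective.factorThru (P := ModuleCat.of R (Fin n → R))
    a.hom b.hom), ?_⟩
  apply ObjectProperty.hom_ext
  exact Projective.factorThru_comp (P := ModuleCat.of R (Fin n → R)) a.hom b.hom

lemma module_projective (P : FGModuleCat.{u} R) [IsNoetherianRing R] [Projective P] :
    Module.Projective R P.obj := by
  obtain ⟨n, e, he⟩ := exists_epi_of_free P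
  have := epi_of_surjective e he
  exact Module.Projective.of_split (M := Fin n → R)
    (Projective.factorThru (𝟙 P) e).hom.hom e.hom.hom
    (congrArg (fun g => g.hom.hom) (Projective.factorThru_comp (𝟙 P) e))

instance [IsNoetherianRing R] : EnoughProjectives (FGModuleCat.{u} R) where
  presentation X := by
    obtain ⟨n, e, he⟩ := exists_epi_of_free X
    have := epi_of_surjective e he
    exact ⟨{ p := _, f := e }⟩

end FGModuleCat

universe u in
theorem exists_projectiveResolution_finite {R : Type u} [CommRing R] [IsNoetherianRing R]
   (M : Type u) [AddCommGroup M] [Module R M] [Module.Finite R M] :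
   ∃ P : ProjectiveResolution (ModuleCat.of R M), ∀ n, Module.Finite R (P.complex.X n) := by
  let F := forget₂ (FGModuleCat R) (ModuleCat R)
  have : F.PreservesProjectiveObjects := ⟨fun {X} hX => by
    have : Module.Projective R X.obj := X.module_projective
    exact inferInstanceAs (Projective X.obj)⟩
  exact ⟨F.mapProjectiveResolution (ProjectiveResolution.of (FGModuleCat.of R M)),
    fun n => inferInstanceAs (Module.Finite R
      ((ProjectiveResolution.of (FGModuleCat.of R M)).complex.X n).obj)⟩

lemma exists_hom_residueField_ne_zero_iff {R : Type*} [CommRing R] [IsLocalRing R]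
    {W : Type*} [AddCommGroup W] [Module R W] :
    (∃ f : IsLocalRing.ResidueField R →ₗ[R] W, f ≠ 0) ↔
      ∃ w : W, w ≠ 0 ∧ ∀ a ∈ IsLocalRing.maximalIdeal R, a • w = 0 := by
  constructor
  · rintro ⟨f, hf⟩
    refine ⟨f 1, fun h => hf ?_, fun a ha => ?_⟩
    · ext x
      obtain ⟨r, rfl⟩ := IsLocalRing.residue_surjective x
      have : IsLocalRing.residue R r = r • (1 : IsLocalRing.ResidueField R) := by
        rw [Algebra.smul_def, mul_one]; rfl
      rw [this, map_smul, h]; simp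
    · rw [← map_smul, Algebra.smul_def, mul_one]
      have : algebraMap R (IsLocalRing.ResidueField R) a = 0 :=
        (IsLocalRing.residue_eq_zero_iff a).2 ha
      rw [this, map_zero]
  · rintro ⟨w, hw, h⟩
    refine ⟨Submodule.liftQ (IsLocalRing.maximalIdeal R) (LinearMap.toSpanSingleton R W w)
      (fun a ha => h a ha), fun hf => hw ?_⟩
    have := LinearMap.congr_fun hf (Submodule.Quotient.mk 1)
    have h2 := Submodule.liftQ_apply (IsLocalRing.maximalIdeal R)
      (LinearMap.toSpanSingleton R W w) (h := h) 1
    rw [LinearMap.toSpanSingleton_apply, one_smul] at h2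
    exact h2.symm.trans this

/-- `Hom(k, Extⁱ(M, X)) ≠ 0` in terms of cocycles of a projective resolution of `M`. -/
theorem exists_hom_residueField_ext_ne_zero_iff {R : Type*} [CommRing R] [IsLocalRing R]
    {M : Type _} [AddCommGroup M] [Module R M]
    (P : ProjectiveResolution (ModuleCat.of R M)) (X : Type _) [AddCommGroup X] [Module R X] (i : ℕ) :
    (∃ f : IsLocalRing.ResidueField R →ₗ[R]
      (((Ext R (ModuleCat R) i).obj (Opposite.op (ModuleCat.of R M))).obj (ModuleCat.of R X)), f ≠ 0) ↔
    ∃ φ : P.complex.X i →ₗ[R] X, φ ∘ₗ (P.complex.d (i + 1) i).hom = 0 ∧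
      (φ ∉ LinearMap.range (LinearMap.lcomp R X (P.complex.d i ((ComplexShape.up ℕ).prev i)).hom)) ∧
      ∀ a ∈ IsLocalRing.maximalIdeal R,
        a • φ ∈ LinearMap.range
          (LinearMap.lcomp R X (P.complex.d i ((ComplexShape.up ℕ).prev i)).hom) := by
  let K := (P.complex.linearYonedaObj R (ModuleCat.of R X)).sc'
    ((ComplexShape.up ℕ).prev i) i (i + 1)
  let e : (((Ext R (ModuleCat R) i).obj (Opposite.op (ModuleCat.of R M))).obj (ModuleCat.of R X)) ≃ₗ[R]
      (LinearMap.ker K.g.hom ⧸ LinearMap.range K.moduleCatToCycles) :=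
    (P.isoExt (R := R) i (ModuleCat.of R X) ≪≫ ShortComplex.homologyMapIso
      ((P.complex.linearYonedaObj R (ModuleCat.of R X)).isoSc' _ i (i + 1) rfl (by simp)) ≪≫
      K.moduleCatHomologyIso).toLinearEquiv
  rw [exists_hom_residueField_ne_zero_iff]
  have hr : ∀ φ : LinearMap.ker K.g.hom, φ ∈ LinearMap.range K.moduleCatToCycles ↔
      ModuleCat.Hom.hom φ.1 ∈ LinearMap.range
        (LinearMap.lcomp R X (P.complex.d i ((ComplexShape.up ℕ).prev i)).hom) := by
    intro φ
    constructor
    · rintro ⟨ψ, rfl⟩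
      exact ⟨ModuleCat.Hom.hom ψ, rfl⟩
    · rintro ⟨ψ, hψ⟩
      exact ⟨ModuleCat.ofHom ψ, Subtype.ext (ModuleCat.hom_ext hψ)⟩
  constructor
  · rintro ⟨w, hw, h⟩
    obtain ⟨φ, hφ⟩ := Submodule.mkQ_surjective _ (e w)
    refine ⟨ModuleCat.Hom.hom φ.1, congrArg ModuleCat.Hom.hom φ.2, ?_, fun a ha => ?_⟩
    · rw [← hr, ← Submodule.Quotient.mk_eq_zero, ← Submodule.mkQ_apply, hφ]
      simpa using hw
    · have := (hr (a • φ)).1 (by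
        rw [← Submodule.Quotient.mk_eq_zero, ← Submodule.mkQ_apply, map_smul, hφ, ← map_smul, h a ha,
          map_zero])
      exact this
  · rintro ⟨φ, h0, h1, h2⟩
    let φ' : LinearMap.ker K.g.hom := ⟨ModuleCat.ofHom φ, ModuleCat.hom_ext h0⟩
    refine ⟨e.symm (Submodule.mkQ _ φ'), ?_, fun a ha => ?_⟩
    · rw [Ne, LinearEquiv.map_eq_zero_iff, Submodule.mkQ_apply, Submodule.Quotient.mk_eq_zero, hr]
      exact h1
    · rw [← map_smul, LinearEquiv.map_eq_zero_iff, ← map_smul, Submodule.mkQ_apply,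
        Submodule.Quotient.mk_eq_zero, hr]
      exact h2 a ha
section

open MvPolynomial

variable {R : Type*} [CommRing R] {σ : Type*} [Fintype σ]

/-- The multi-Rees algebra of finitely many finitely generated ideals is the image of a polynomial
ring in finitely many variables. -/
theorem exists_mvPolynomial_algHom_range_rees [IsNoetherianRing R] (I : σ → Ideal R) :
    ∃ (τ : Type) (_ : Finite τ) (Φ : MvPolynomial τ R →ₐ[R] MvPolynomial σ R),
      (∀ p n, (Φ p).coeff n ∈ ∏ j, I j ^ n j) ∧
      (∀ n, ∀ a ∈ ∏ j, I j ^ n j, monomial n a ∈ Φ.range) := by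
  classical
  have hg (j) : ∃ (m : ℕ) (g : Fin m → R), Ideal.span (Set.range g) = I j :=
    Submodule.fg_iff_exists_fin_generating_family.1 (IsNoetherian.noetherian (I j))
  choose m g hg using hg
  let e := Finite.equivFin ((j : σ) × Fin (m j))
  let Φ : MvPolynomial (Fin (Nat.card ((j : σ) × Fin (m j)))) R →ₐ[R] MvPolynomial σ R :=
    aeval fun x => monomial (Finsupp.single (e.symm x).1 1) (g (e.symm x).1 (e.symm x).2)
  refine ⟨_, inferInstance, Φ, fun p => ?_, fun n a ha => ?_⟩
  · induction p using MvPolynomial.induction_on with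
    | C a =>
      intro n
      rw [← algebraMap_eq, AlgHom.commutes, algebraMap_eq, coeff_C]
      split_ifs with h
      · simp [← h, Ideal.top_pow]
      · exact zero_mem _
    | add p q hp hq =>
      intro n
      rw [map_add, coeff_add]; exact add_mem (hp n) (hq n)
    | mul_X p x hp =>
      intro n
      rw [map_mul, show Φ (X x) = _ from aeval_X _ _, coeff_mul_monomial']
      split_ifs with h
      · obtain ⟨n', rfl⟩ := exists_add_of_le h
        rw [add_tsub_cancel_left]
        have := Ideal.mul_mem_mul (hp n') (show g (e.symm x).1 (e.symm x).2 ∈ I (e.symm x).1 by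
          rw [← hg]; exact Ideal.subset_span ⟨_, rfl⟩)
        convert this using 1
        simp only [Finsupp.coe_add, Pi.add_apply, pow_add, Finset.prod_mul_distrib]
        rw [mul_comm]
        congr 1
        rw [Finset.prod_eq_single (e.symm x).1] <;> simp +contextual
      · exact zero_mem _
  · let K : (σ →₀ ℕ) → Ideal R := fun n =>
      (Subalgebra.toSubmodule Φ.range).comap (monomial n)
    have hK (a b) : K a * K b ≤ K (a + b) := by
      rw [Ideal.mul_le]
      intro r hr s hs
      have := Φ.range.mul_mem hr hs
      rwa [monomial_mul] at this
    have hK0 : K 0 = ⊤ := by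
      rw [Ideal.eq_top_iff_one]
      exact one_mem Φ.range
    have hI (j) : I j ≤ K (Finsupp.single j 1) := by
      rw [← hg, Ideal.span_le]
      rintro _ ⟨x, rfl⟩
      refine ⟨X (e ⟨j, x⟩), ?_⟩
      change Φ _ = _
      rw [show Φ (X (e ⟨j, x⟩)) = _ from aeval_X _ _, Equiv.symm_apply_apply]
    have hpow (j) (k : ℕ) : I j ^ k ≤ K (Finsupp.single j k) := by
      induction k with
      | zero => rw [Finsupp.single_zero, hK0]; exact le_top
      | succ k ih =>
        rw [pow_succ, Finsupp.single_add]
        exact (Ideal.mul_mono ih (hI j)).trans (hK _ _)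
    have hprod (s : Finset σ) : ∏ j ∈ s, I j ^ n j ≤ K (∑ j ∈ s, Finsupp.single j (n j)) := by
      induction s using Finset.induction_on with
      | empty => rw [Finset.sum_empty, hK0]; exact le_top
      | insert j s hj ih =>
        rw [Finset.prod_insert hj, Finset.sum_insert hj]
        exact (Ideal.mul_mono (hpow j _) ih).trans (hK _ _)
    have := hprod Finset.univ ha
    rwa [Finsupp.univ_sum_single] at this

/-- The Artin–Rees lemma for several ideals. -/
theorem exists_prod_pow_smul_inf_le [IsNoetherianRing R] (I : σ → Ideal R) {G : Type*}
    [AddCommGroup G] [Module R G] [Module.Finite R G] (H L : Submodule R G) :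
    ∃ c : ℕ, ∀ n : σ → ℕ, (∀ j, c ≤ n j) →
      (∏ j, I j ^ n j) • H ⊓ L ≤ (∏ j, I j ^ (n j - c)) • ((∏ j, I j ^ c) • H ⊓ L) := by
  classical
  obtain ⟨τ, _, Φ, hΦ, hΦ'⟩ := exists_mvPolynomial_algHom_range_rees I
  obtain ⟨s, π, hπ⟩ := Module.Finite.exists_fin' R H
  let π' : (Fin s → R) →ₗ[R] G := H.subtype ∘ₗ π
  let cf (n : σ →₀ ℕ) : (Fin s → MvPolynomial τ R) →ₗ[R] (Fin s → R) :=
    LinearMap.compLeft (lcoeff R n ∘ₗ Φ.toLinearMap) (Fin s)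
  have hcf (n p v) : cf n (p • v) =
      ∑ x ∈ Finset.HasAntidiagonal.antidiagonal n, (Φ p).coeff x.1 • cf x.2 v := by
    ext k
    simp [cf, coeff_mul]
  let 𝓛 : Submodule (MvPolynomial τ R) (Fin s → MvPolynomial τ R) :=
    { carrier := {v | ∀ n, π' (cf n v) ∈ L}
      add_mem' := fun {a b} ha hb n => by
        rw [map_add, map_add]; exact add_mem (ha n) (hb n)
      zero_mem' := fun n => by rw [map_zero, map_zero]; exact zero_mem _
      smul_mem' := fun p v hv n => by
        rw [hcf, map_sum]
        refine sum_mem fun x _ => ?_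
        rw [map_smul]
        exact L.smul_mem _ (hv _) }
  obtain ⟨S, hS⟩ := (IsNoetherian.noetherian 𝓛)
  have hSL : ∀ v ∈ S, v ∈ 𝓛 := fun v hv => hS ▸ Submodule.subset_span hv
  have hbdd (d : (Fin s → MvPolynomial τ R) → Fin s → σ → ℕ) :
      ∃ c, ∀ v ∈ S, ∀ k j, d v k j ≤ c :=
    ⟨(S ×ˢ (Finset.univ : Finset (Fin s × σ))).sup fun x => d x.1 x.2.1 x.2.2, fun v hv k j =>
      Finset.le_sup (f := fun x : _ × Fin s × σ => d x.1 x.2.1 x.2.2) (b := (v, k, j))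
        (Finset.mem_product.2 ⟨hv, Finset.mem_univ _⟩)⟩
  obtain ⟨c, hdeg⟩ := hbdd fun v k j => (Φ (v k)).degreeOf j
  have hc (v) (hv : v ∈ S) (n : σ →₀ ℕ) (hn : cf n v ≠ 0) (j) : n j ≤ c := by
    obtain ⟨k, hk⟩ := Function.ne_iff.1 hn
    exact (monomial_le_degreeOf j (mem_support_iff.2 hk)).trans (hdeg v hv k j)
  have hcoef (v) (n : σ →₀ ℕ) : π' (cf n v) ∈ (∏ j, I j ^ n j) • H := by
    have : cf n v = ∑ k, (Φ (v k)).coeff n • Pi.single k 1 := by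
      ext k; simp [cf, Pi.single_apply]
    rw [this, map_sum]
    refine sum_mem fun k _ => ?_
    rw [map_smul]
    exact Submodule.smul_mem_smul (hΦ _ _) (SetLike.coe_mem _)
  refine ⟨c, fun n hn y hy => ?_⟩
  let n' : σ →₀ ℕ := Finsupp.equivFunOnFinite.symm n
  have key : ∀ v ∈ 𝓛, π' (cf n' v) ∈ (∏ j, I j ^ (n j - c)) • ((∏ j, I j ^ c) • H ⊓ L) := by
    intro v hv
    rw [← hS, Submodule.mem_span_finset] at hv
    obtain ⟨f, -, rfl⟩ := hv
    rw [map_sum, map_sum]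
    refine sum_mem fun v hv => ?_
    rw [hcf, map_sum]
    refine sum_mem fun x hx => ?_
    rw [map_smul]
    rcases eq_or_ne (cf x.2 v) 0 with h0 | h0
    · rw [h0, map_zero, smul_zero]; exact zero_mem _
    have hle := hc v hv _ h0
    have hadd (j) : x.1 j + x.2 j = n j :=
      DFunLike.congr_fun (Finset.HasAntidiagonal.mem_antidiagonal.1 hx) j
    have h1 : ∏ j, I j ^ x.1 j = (∏ j, I j ^ (n j - c)) * ∏ j, I j ^ (c - x.2 j) := by
      rw [← Finset.prod_mul_distrib]
      refine Finset.prod_congr rfl fun j _ => ?_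
      rw [← pow_add]
      congr 1
      have := hle j
      have := hadd j
      have := hn j
      omega
    have h2 : ∏ j, I j ^ c = (∏ j, I j ^ (c - x.2 j)) * ∏ j, I j ^ x.2 j := by
      rw [← Finset.prod_mul_distrib]
      refine Finset.prod_congr rfl fun j _ => ?_
      rw [← pow_add, Nat.sub_add_cancel (hle j)]
    have h3 := Submodule.smul_mem_smul (hΦ (f v) x.1)
      (Submodule.mem_inf.2 ⟨hcoef v x.2, hSL v hv x.2⟩)
    rw [h1, Submodule.mul_smul] at h3
    refine Submodule.smul_mono le_rfl (le_inf ?_ ?_) h3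
    · rw [h2, Submodule.mul_smul]
      exact Submodule.smul_mono le_rfl inf_le_left
    · exact Submodule.smul_le_right.trans inf_le_right
  obtain ⟨hyH, hyL⟩ := hy
  have : ∃ v, π' (cf n' v) = y ∧ v ∈ 𝓛 := by
    have : y ∈ Submodule.map π' ((∏ j, I j ^ n j) • ⊤) := by
      rw [Submodule.map_smul'', Submodule.map_top, LinearMap.range_comp, LinearMap.range_eq_top.2 hπ]
      simpa using hyH
    obtain ⟨u, hu, rfl⟩ := this
    have hu' (k) : u k ∈ ∏ j, I j ^ n j := by
      have : (∏ j, I j ^ n j) • (⊤ : Submodule R (Fin s → R)) ≤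
        Submodule.comap (LinearMap.proj k) (∏ j, I j ^ n j : Ideal R) := by
        rw [Submodule.smul_le]
        intro r hr w _
        exact Ideal.mul_mem_right _ _ hr
      exact this hu
    choose v hv using fun k => hΦ' n' (u k) (hu' k)
    have hv' (e) : cf e v = if e = n' then u else 0 := by
      ext k
      have : Φ (v k) = _ := hv k
      simp [cf, this, coeff_monomial, eq_comm]
      split_ifs <;> simp
    refine ⟨v, by simp [hv'], fun e => ?_⟩
    rw [hv']
    split_ifs
    · exact hyL
    · simp
  obtain ⟨v, rfl, hv⟩ := this
  exact key v hv
end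

section
variable {R : Type*} [CommRing R] {σ : Type*} [Fintype σ]

lemma Submodule.ideal_smul_prod {G₁ G₂ : Type*}
    [AddCommGroup G₁] [Module R G₁] [AddCommGroup G₂] [Module R G₂]
    (J : Ideal R) (H₁ : Submodule R G₁) (H₂ : Submodule R G₂) :
    J • H₁.prod H₂ = (J • H₁).prod (J • H₂) := by
  rw [LinearMap.prod_eq_sup_map, LinearMap.prod_eq_sup_map, Submodule.smul_sup,
    Submodule.map_smul'', Submodule.map_smul'']

lemma Submodule.ideal_smul_pi {ι : Type*} [Finite ι] {G : Type*} [AddCommGroup G] [Module R G]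
    (J : Ideal R) (H : Submodule R G) :
    J • Submodule.pi Set.univ (fun _ : ι => H) = Submodule.pi Set.univ (fun _ : ι => J • H) := by
  classical
  have := Fintype.ofFinite ι
  refine le_antisymm ?_ fun x hx => ?_
  · rw [Submodule.smul_le]
    exact fun r hr x hx i hi => Submodule.smul_mem_smul hr (hx i hi)
  · rw [← Finset.univ_sum_single x]
    refine sum_mem fun i _ => ?_
    have : J • H ≤ (J • Submodule.pi Set.univ (fun _ : ι => H)).comap (LinearMap.single R _ i) := by
      rw [← Submodule.map_le_iff_le_comap, Submodule.map_smul'']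
      refine Submodule.smul_mono le_rfl ?_
      rintro _ ⟨y, hy, rfl⟩ j -
      by_cases h : j = i
      · subst h; simpa using hy
      · simp [h]
    exact this (hx i trivial)

/-- For powers of several ideals over a local ring, the preimage of `I ^ n • H` is either contained
in `I ^ n • D` for all large `n`, or not contained in it for all large `n`. -/
theorem comap_prod_pow_smul_le_dichotomy [IsNoetherianRing R] [IsLocalRing R]
    (I : σ → Ideal R) {C G : Type*} [AddCommGroup C]
    [Module R C] [Module.Finite R C] [AddCommGroup G] [Module R G] [Module.Finite R G]
    (h : C →ₗ[R] G) (H : Submodule R G) (D : Submodule R C) :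
    (∃ k : ℕ, ∀ n : σ → ℕ, (∀ j, k ≤ n j) →
      ((∏ j, I j ^ n j) • H).comap h ≤ (∏ j, I j ^ n j) • D) ∨
    (∃ k : ℕ, ∀ n : σ → ℕ, (∀ j, k ≤ n j) →
      ¬ ((∏ j, I j ^ n j) • H).comap h ≤ (∏ j, I j ^ n j) • D) := by
  by_cases htop : ∀ j, I j = ⊤
  · simp only [htop, Ideal.top_pow, Finset.prod_const]
    by_cases hle : ((⊤ : Ideal R) • H).comap h ≤ (⊤ : Ideal R) • D
    · exact .inl ⟨0, fun _ _ => hle⟩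
    · exact .inr ⟨0, fun _ _ => hle⟩
  push Not at htop
  obtain ⟨j₀, hj₀⟩ := htop
  by_cases hker : LinearMap.ker h = ⊥
  swap
  · obtain ⟨x, hx, hx0⟩ := Submodule.exists_mem_ne_zero_of_ne_bot hker
    have hinf := Ideal.iInf_pow_smul_eq_bot_of_isLocalRing (M := C) (I j₀) hj₀
    obtain ⟨k, hk⟩ : ∃ k, x ∉ I j₀ ^ k • (⊤ : Submodule R C) := by
      by_contra! hall
      exact hx0 ((Submodule.mem_bot R).1 (hinf ▸ (Submodule.mem_iInf _).2 hall))
    refine .inr ⟨k, fun n hn hle => hk ?_⟩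
    have : x ∈ ((∏ j, I j ^ n j) • H).comap h := by
      rw [Submodule.mem_comap, LinearMap.mem_ker.1 hx]; exact zero_mem _
    refine Submodule.smul_mono ?_ le_top (hle this)
    exact (Ideal.prod_le_inf.trans (Finset.inf_le (Finset.mem_univ j₀))).trans
      (Ideal.pow_le_pow_right (hn j₀))
  by_cases hex : ∃ a : σ → ℕ, ∃ x ∈ ((∏ j, I j ^ a j) • H).comap h, ∀ b : σ → ℕ,
      ¬ (∏ j, I j ^ b j) • Submodule.span R {x} ≤ (∏ j, I j ^ (b j + a j)) • D
  · obtain ⟨a, x, hx, hb⟩ := hex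
    refine .inr ⟨Finset.univ.sup a, fun n hn hle => hb (fun j => n j - a j) ?_⟩
    have hn' (j) : n j - a j + a j = n j :=
      Nat.sub_add_cancel ((Finset.le_sup (Finset.mem_univ j)).trans (hn j))
    simp only [hn']
    refine le_trans ?_ hle
    rw [← Submodule.map_le_iff_le_comap, Submodule.map_smul'']
    have : (∏ j, I j ^ n j) = (∏ j, I j ^ (n j - a j)) * ∏ j, I j ^ a j := by
      rw [← Finset.prod_mul_distrib]
      exact Finset.prod_congr rfl fun j _ => by rw [← pow_add, hn']
    rw [this, Submodule.mul_smul]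
    refine Submodule.smul_mono le_rfl ?_
    rw [Submodule.map_le_iff_le_comap, Submodule.span_singleton_le_iff_mem]
    exact hx
  push Not at hex
  obtain ⟨c, hc⟩ := exists_prod_pow_smul_inf_le I H (LinearMap.range h)
  obtain ⟨S, hS⟩ := IsNoetherian.noetherian (((∏ j, I j ^ c) • H).comap h)
  choose! b hb using fun x (hx : x ∈ S) => hex (fun _ => c) x (hS ▸ Submodule.subset_span hx)
  let B : ℕ := S.sup fun x => Finset.univ.sup (b x)
  have hB (x) (hx : x ∈ S) (j) : b x j ≤ B :=
    (Finset.le_sup (f := b x) (Finset.mem_univ j)).trans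
      (Finset.le_sup (f := fun x => Finset.univ.sup (b x)) hx)
  refine .inl ⟨B + c, fun n hn x hx => ?_⟩
  have hmem := hc n (fun j => (Nat.le_add_left _ _).trans (hn j)) ⟨hx, x, rfl⟩
  rw [inf_comm, ← Submodule.map_comap_eq, ← Submodule.map_smul''] at hmem
  obtain ⟨y, hy, hyx⟩ := hmem
  obtain rfl : y = x := LinearMap.ker_eq_bot.1 hker hyx
  suffices (∏ j, I j ^ (n j - c)) • ((∏ j, I j ^ c) • H).comap h ≤ (∏ j, I j ^ n j) • D from this hy
  rw [← hS, Submodule.span_eq_iSup_of_singleton_spans, Submodule.smul_iSup]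
  simp only [Submodule.smul_iSup]
  refine iSup₂_le fun x hx => ?_
  have h1 : ∏ j, I j ^ (n j - c) = (∏ j, I j ^ (n j - c - b x j)) * ∏ j, I j ^ b x j := by
    rw [← Finset.prod_mul_distrib]
    refine Finset.prod_congr rfl fun j _ => ?_
    rw [← pow_add]
    congr 1
    have := hB x hx j
    have := hn j
    omega
  have h2 : ∏ j, I j ^ n j = (∏ j, I j ^ (n j - c - b x j)) * ∏ j, I j ^ (b x j + c) := by
    rw [← Finset.prod_mul_distrib]
    refine Finset.prod_congr rfl fun j _ => ?_
    rw [← pow_add]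
    congr 1
    have := hB x hx j
    have := hn j
    omega
  rw [h1, h2, Submodule.mul_smul, Submodule.mul_smul]
  exact Submodule.smul_mono le_rfl (hb x hx)

/-- The subquotients `g⁻¹(I ^ n • H) / (B + I ^ n • D)` either have zero socle for all large `n`,
or nonzero socle for all large `n`. -/
theorem socle_dichotomy [IsNoetherianRing R] [IsLocalRing R]
    (I : σ → Ideal R) {C G : Type*} [AddCommGroup C]
    [Module R C] [Module.Finite R C] [AddCommGroup G] [Module R G] [Module.Finite R G]
    (g : C →ₗ[R] G) (H : Submodule R G) (B D : Submodule R C) (hB : B ≤ LinearMap.ker g) :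
    (∃ k : ℕ, ∀ n : σ → ℕ, (∀ j, k ≤ n j) → ¬ ∃ x, g x ∈ (∏ j, I j ^ n j) • H ∧
      x ∉ B ⊔ (∏ j, I j ^ n j) • D ∧
      ∀ a ∈ IsLocalRing.maximalIdeal R, a • x ∈ B ⊔ (∏ j, I j ^ n j) • D) ∨
    (∃ k : ℕ, ∀ n : σ → ℕ, (∀ j, k ≤ n j) → ∃ x, g x ∈ (∏ j, I j ^ n j) • H ∧
      x ∉ B ⊔ (∏ j, I j ^ n j) • D ∧
      ∀ a ∈ IsLocalRing.maximalIdeal R, a • x ∈ B ⊔ (∏ j, I j ^ n j) • D) := by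
  obtain ⟨r, m, hm⟩ := Submodule.fg_iff_exists_fin_generating_family.1
    (IsNoetherian.noetherian (IsLocalRing.maximalIdeal R))
  let D' := D.map B.mkQ
  have hD' (J : Ideal R) (x : C) : B.mkQ x ∈ J • D' ↔ x ∈ B ⊔ J • D := by
    rw [← Submodule.map_smul'', ← Submodule.mem_comap, Submodule.comap_map_mkQ]
  let h : C ⧸ B →ₗ[R] G × (Fin r → C ⧸ B) :=
    (B.liftQ g hB).prod (LinearMap.pi fun l => m l • LinearMap.id)
  have hh (J : Ideal R) (x : C) :
      B.mkQ x ∈ (J • H.prod (Submodule.pi Set.univ fun _ => D')).comap h ↔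
      g x ∈ J • H ∧ ∀ a ∈ IsLocalRing.maximalIdeal R, a • x ∈ B ⊔ J • D := by
    rw [Submodule.ideal_smul_prod, Submodule.ideal_smul_pi]
    have h1 : (∀ a ∈ IsLocalRing.maximalIdeal R, a • x ∈ B ⊔ J • D) ↔
        ∀ l, m l • x ∈ B ⊔ J • D := by
      refine ⟨fun H l => H _ (hm ▸ Submodule.subset_span ⟨l, rfl⟩), fun H a ha => ?_⟩
      have : IsLocalRing.maximalIdeal R ≤
          (B ⊔ J • D).comap (LinearMap.toSpanSingleton R C x) := by
        rw [← hm, Submodule.span_le]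
        rintro _ ⟨l, rfl⟩
        exact H l
      exact this ha
    rw [h1]
    simp only [← hD']
    simp [h, Submodule.mem_pi, Submodule.mem_prod]
  have hiff (J : Ideal R) : (∃ x, g x ∈ J • H ∧ x ∉ B ⊔ J • D ∧
      ∀ a ∈ IsLocalRing.maximalIdeal R, a • x ∈ B ⊔ J • D) ↔
      ¬ (J • H.prod (Submodule.pi Set.univ fun _ => D')).comap h ≤ J • D' := by
    rw [SetLike.not_le_iff_exists, B.mkQ_surjective.exists]
    simp only [hh, hD']
    exact exists_congr fun x => by tauto
  simp only [hiff, not_not]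
  exact comap_prod_pow_smul_le_dichotomy I h _ D'


lemma mem_smul_range_compRight_subtype_iff {P N : Type*}
    [AddCommGroup P] [Module R P] [Module.Finite R P]
    [Module.Projective R P] [AddCommGroup N] [Module R N] (N' : Submodule R N) (J : Ideal R)
    (φ : P →ₗ[R] N) :
    φ ∈ J • LinearMap.range (LinearMap.compRight R (M := P) N'.subtype) ↔
      (J • N').mkQ ∘ₗ φ = 0 := by
  constructor
  · intro h
    change φ ∈ LinearMap.ker (LinearMap.compRight R (M := P) (J • N').mkQ)
    revert φ
    rw [← SetLike.le_def, Submodule.smul_le]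
    rintro r hr _ ⟨ψ, rfl⟩
    rw [LinearMap.mem_ker]
    ext p
    exact (Submodule.Quotient.mk_eq_zero _).2 (Submodule.smul_mem_smul hr (SetLike.coe_mem (ψ p)))
  · intro h
    obtain ⟨n, f, g, -, -, hfg⟩ := Module.Finite.exists_comp_eq_id_of_projective R P
    let T (k : Fin n) : N →ₗ[R] P →ₗ[R] N :=
      LinearMap.smulRightₗ (LinearMap.proj k ∘ₗ g)
    have hφ : φ = ∑ k, T k (φ (f (Pi.single k 1))) := by
      ext p
      have hp : f (g p) = p := LinearMap.congr_fun hfg p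
      conv_lhs => rw [← hp, ← Finset.univ_sum_single (g p)]
      simp only [map_sum, LinearMap.sum_apply]
      refine Finset.sum_congr rfl fun k _ => ?_
      have : Pi.single k (g p k) = g p k • (Pi.single k 1 : Fin n → R) := by
        rw [← Pi.single_smul, smul_eq_mul, mul_one]
      rw [this, map_smul, map_smul]
      rfl
    rw [hφ]
    refine sum_mem fun k _ => ?_
    have hT : J • N' ≤ (J • LinearMap.range (LinearMap.compRight R (M := P) N'.subtype)).comap
        (T k) := by
      rw [← Submodule.map_le_iff_le_comap, Submodule.map_smul'']
      refine Submodule.smul_mono le_rfl ?_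
      rintro _ ⟨y, hy, rfl⟩
      exact ⟨LinearMap.smulRight (LinearMap.proj k ∘ₗ g) ⟨y, hy⟩, rfl⟩
    exact hT ((Submodule.Quotient.mk_eq_zero _).1 (LinearMap.congr_fun h (f (Pi.single k 1))))

lemma mkQ_comp_mem_range_lcomp_iff {P P' N : Type*}
    [AddCommGroup P] [Module R P] [Module.Finite R P]
    [Module.Projective R P] [AddCommGroup P'] [Module R P'] [Module.Projective R P']
    [AddCommGroup N] [Module R N] (N' : Submodule R N) (J : Ideal R)
    (u : P →ₗ[R] P') (φ : P →ₗ[R] N) :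
    (J • N').mkQ ∘ₗ φ ∈ LinearMap.range (LinearMap.lcomp R (N ⧸ J • N') u) ↔
      φ ∈ LinearMap.range (LinearMap.lcomp R N u) ⊔
        J • LinearMap.range (LinearMap.compRight R (M := P) N'.subtype) := by
  rw [Submodule.mem_sup]
  constructor
  · rintro ⟨ψ, hψ⟩
    obtain ⟨ψ', rfl⟩ := Module.projective_lifting_property _ ψ (J • N').mkQ_surjective
    refine ⟨_, ⟨ψ', rfl⟩, φ - ψ' ∘ₗ u, ?_, add_sub_cancel _ _⟩
    rw [mem_smul_range_compRight_subtype_iff, LinearMap.comp_sub, sub_eq_zero, ← hψ]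
    rfl
  · rintro ⟨_, ⟨ψ, rfl⟩, χ, hχ, rfl⟩
    rw [mem_smul_range_compRight_subtype_iff] at hχ
    exact ⟨(J • N').mkQ ∘ₗ ψ, by rw [LinearMap.comp_add, hχ, add_zero]; rfl⟩
end

/-- **Key lemma.** Over a Noetherian local ring `(R, 𝔪, k)`, with
`Wₙ = Ext_R^i(M, N/(I₁^{n₁}⋯I_t^{n_t})N')`, either `Hom_R(k, Wₙ) = 0` for all
sufficiently large `n`, or `Hom_R(k, Wₙ) ≠ 0` for all sufficiently large `n`. -/
theorem hom_residue_ext_dichotomy (R : Type) [CommRing R] [IsNoetherianRing R]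
    [IsLocalRing R] (t : ℕ) (I : Fin t → Ideal R) (M N : Type)
    [AddCommGroup M] [Module R M] [Module.Finite R M]
    [AddCommGroup N] [Module R N] [Module.Finite R N]
    (N' : Submodule R N) (i : ℕ) :
    (∃ k : ℕ, ∀ n : Fin t → ℕ, (∀ j, k ≤ n j) →
      ∀ f : IsLocalRing.ResidueField R →ₗ[R]
        (((Ext R (ModuleCat R) i).obj (Opposite.op (ModuleCat.of R M))).obj
          (ModuleCat.of R (N ⧸ ((∏ j, I j ^ n j) • N')))), f = 0) ∨
    (∃ k : ℕ, ∀ n : Fin t → ℕ, (∀ j, k ≤ n j) →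
      ∃ f : IsLocalRing.ResidueField R →ₗ[R]
        (((Ext R (ModuleCat R) i).obj (Opposite.op (ModuleCat.of R M))).obj
          (ModuleCat.of R (N ⧸ ((∏ j, I j ^ n j) • N')))), f ≠ 0) := by
  obtain ⟨P, hP⟩ := exists_projectiveResolution_finite (R := R) M
  have hproj (n) : Module.Projective R (P.complex.X n) :=
    (IsProjective.iff_projective _).2 (P.projective n)
  let u := (P.complex.d i ((ComplexShape.up ℕ).prev i)).hom
  let v := (P.complex.d (i + 1) i).hom
  have huv : u ∘ₗ v = 0 := congrArg ModuleCat.Hom.hom (P.complex.d_comp_d _ _ _)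
  have hB : LinearMap.range (LinearMap.lcomp R N u) ≤ LinearMap.ker (LinearMap.lcomp R N v) := by
    rintro _ ⟨ψ, rfl⟩
    change (ψ ∘ₗ u) ∘ₗ v = 0
    rw [LinearMap.comp_assoc, huv, LinearMap.comp_zero]
  have hiff (J : Ideal R) : (∃ f : IsLocalRing.ResidueField R →ₗ[R]
        (((Ext R (ModuleCat R) i).obj (Opposite.op (ModuleCat.of R M))).obj
          (ModuleCat.of R (N ⧸ (J • N')))), f ≠ 0) ↔
      ∃ x, LinearMap.lcomp R N v x ∈ J • LinearMap.range (LinearMap.compRight R N'.subtype) ∧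
        x ∉ LinearMap.range (LinearMap.lcomp R N u) ⊔
          J • LinearMap.range (LinearMap.compRight R N'.subtype) ∧
        ∀ a ∈ IsLocalRing.maximalIdeal R, a • x ∈ LinearMap.range (LinearMap.lcomp R N u) ⊔
          J • LinearMap.range (LinearMap.compRight R N'.subtype) := by
    rw [exists_hom_residueField_ext_ne_zero_iff P]
    have hsurj : Function.Surjective
        fun x : P.complex.X i →ₗ[R] N => (J • N').mkQ ∘ₗ x := fun φ =>
      Module.projective_lifting_property _ φ (J • N').mkQ_surjective
    rw [hsurj.exists]
    refine exists_congr fun x => ?_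
    simp only [← mkQ_comp_mem_range_lcomp_iff, mem_smul_range_compRight_subtype_iff]
    rfl
  rcases socle_dichotomy I (LinearMap.lcomp R N v) (LinearMap.range (LinearMap.compRight R N'.subtype))
    (LinearMap.range (LinearMap.lcomp R N u))
    (LinearMap.range (LinearMap.compRight R N'.subtype)) hB with ⟨k, hk⟩ | ⟨k, hk⟩
  · refine .inl ⟨k, fun n hn f => ?_⟩
    by_contra hf
    exact hk n hn ((hiff _).1 ⟨f, hf⟩)
  · exact .inr ⟨k, fun n hn => (hiff _).2 (hk n hn)⟩
end

section
/- Let (R, m, k) be a commutative Noetherian local ring, I an ideal, M, N finitely generated R-modules, and fix i ≥ 0. Then either Tor_i^R(M, N/I^n N) has m as an associated prime for all sufficiently large n, or m is not an associated prime of Tor_i^R(M, N/I^n N) for any sufficiently large n. -/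
open CategoryTheory

theorem Ideal.comap_pow_smul_top_dichotomy {R P D : Type*} [CommRing R] [IsNoetherianRing R]
    [IsLocalRing R] (I : Ideal R) [AddCommGroup P] [Module R P] [Module.Finite R P]
    [AddCommGroup D] [Module R D] [Module.Finite R D] (g : P →ₗ[R] D) :
    (∃ K : ℕ, ∀ n : ℕ, K ≤ n →
      ¬ (I ^ n • ⊤ : Submodule R D).comap g ≤ (I ^ n • ⊤ : Submodule R P)) ∨
    (∃ K : ℕ, ∀ n : ℕ, K ≤ n →
      (I ^ n • ⊤ : Submodule R D).comap g ≤ (I ^ n • ⊤ : Submodule R P)) := by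
  rcases eq_or_ne I ⊤ with rfl | hI
  · exact .inr ⟨0, fun n _ ↦ by simp [Ideal.top_pow]⟩
  by_cases hg : Function.Injective g
  · obtain ⟨k, hk⟩ := I.exists_pow_inf_eq_pow_smul (LinearMap.range g)
    have key : ∀ n ≥ k, (I ^ n • ⊤ : Submodule R D).comap g =
        I ^ (n - k) • (I ^ k • ⊤ : Submodule R D).comap g := by
      intro n hn
      apply Submodule.map_injective_of_injective hg
      rw [Submodule.map_comap_eq, inf_comm, hk n hn, Submodule.map_smul'',
        Submodule.map_comap_eq, inf_comm]
    by_cases h : ∃ n ≥ k, (I ^ n • ⊤ : Submodule R D).comap g ≤ (I ^ n • ⊤ : Submodule R P)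
    · obtain ⟨n, hn, hle⟩ := h
      refine .inr ⟨n, fun m hm ↦ ?_⟩
      calc (I ^ m • ⊤ : Submodule R D).comap g
          = I ^ (m - n) • (I ^ n • ⊤ : Submodule R D).comap g := by
            rw [key m (hn.le.trans hm), key n hn, ← Submodule.mul_smul, ← pow_add]
            congr 2
            omega
        _ ≤ I ^ (m - n) • (I ^ n • ⊤ : Submodule R P) := smul_mono_right _ hle
        _ = I ^ m • ⊤ := by rw [← Submodule.mul_smul, ← pow_add, Nat.sub_add_cancel hm]
    · push Not at h
      exact .inl ⟨k, h⟩
  · rw [← LinearMap.ker_eq_bot, Submodule.eq_bot_iff] at hg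
    push Not at hg
    obtain ⟨x, hx, hx0⟩ := hg
    have hx' : x ∉ (⨅ n : ℕ, I ^ n • ⊤ : Submodule R P) := by
      rwa [I.iInf_pow_smul_eq_bot_of_isLocalRing hI, Submodule.mem_bot]
    rw [Submodule.mem_iInf, not_forall] at hx'
    obtain ⟨K, hK⟩ := hx'
    refine .inl ⟨K, fun n hn hle ↦ hK ?_⟩
    refine Submodule.smul_mono_left (Ideal.pow_le_pow_right hn) (hle ?_)
    rw [Submodule.mem_comap, LinearMap.mem_ker.mp hx]
    exact zero_mem _

theorem Submodule.mem_smul_top_prod {R C D : Type*} [CommRing R] (I : Ideal R)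
    [AddCommGroup C] [Module R C] [AddCommGroup D] [Module R D] (x : C × D) :
    x ∈ (I • ⊤ : Submodule R (C × D)) ↔
      x.1 ∈ (I • ⊤ : Submodule R C) ∧ x.2 ∈ (I • ⊤ : Submodule R D) := by
  refine ⟨fun h ↦ ⟨smul_top_le_comap_smul_top I (.fst R C D) h,
    smul_top_le_comap_smul_top I (.snd R C D) h⟩, fun ⟨h₁, h₂⟩ ↦ ?_⟩
  have : LinearMap.inl R C D x.1 + LinearMap.inr R C D x.2 ∈ (I • ⊤ : Submodule R (C × D)) :=
    add_mem (smul_top_le_comap_smul_top I (.inl R C D) h₁)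
      (smul_top_le_comap_smul_top I (.inr R C D) h₂)
  simpa using this

theorem Submodule.mem_smul_top_pi {R ι : Type*} [Finite ι] {C : ι → Type*} [CommRing R]
    (I : Ideal R) [∀ j, AddCommGroup (C j)] [∀ j, Module R (C j)] (x : ∀ j, C j) :
    x ∈ (I • ⊤ : Submodule R (∀ j, C j)) ↔ ∀ j, x j ∈ (I • ⊤ : Submodule R (C j)) := by
  classical
  cases nonempty_fintype ι
  refine ⟨fun h j ↦ Submodule.smul_top_le_comap_smul_top I (LinearMap.proj j) h, fun h ↦ ?_⟩
  rw [← Finset.univ_sum_single x]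
  exact sum_mem fun j _ ↦
    Submodule.smul_top_le_comap_smul_top I (LinearMap.single R C j) (h j)

theorem IsLocalRing.maximalIdeal_mem_associatedPrimes_iff {R T : Type*} [CommRing R]
    [IsNoetherianRing R] [IsLocalRing R] [AddCommGroup T] [Module R T] :
    maximalIdeal R ∈ associatedPrimes R T ↔
      ∃ x : T, x ≠ 0 ∧ ∀ a ∈ maximalIdeal R, a • x = 0 := by
  rw [AssociatedPrimes.mem_iff, isAssociatedPrime_iff]
  constructor
  · rintro ⟨hp, x, hx⟩
    refine ⟨x, ?_, fun a ha ↦ ?_⟩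
    · rintro rfl
      exact hp.ne_top (by rw [hx]; simp)
    · rw [hx] at ha
      simpa [Submodule.mem_colon_singleton] using ha
  · rintro ⟨x, hx0, hx⟩
    refine ⟨inferInstance, x, le_antisymm (fun a ha ↦ ?_) (le_maximalIdeal fun h ↦ hx0 ?_)⟩
    · simpa [Submodule.mem_colon_singleton] using hx a ha
    · simpa [Submodule.mem_colon_singleton] using (Ideal.eq_top_iff_one _).mp h

theorem LinearMap.ker_lTensor_mkQ_smul_top {R K N : Type*} [CommRing R] [AddCommGroup K]
    [Module R K] [AddCommGroup N] [Module R N] (J : Ideal R) :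
    LinearMap.ker ((J • ⊤ : Submodule R N).mkQ.lTensor K) =
      (J • ⊤ : Submodule R (TensorProduct R K N)) := by
  apply le_antisymm
  · rw [lTensor_mkQ]
    rintro _ ⟨t, rfl⟩
    induction t with
    | zero => simp
    | add s t hs ht => rw [map_add]; exact add_mem hs ht
    | tmul k n =>
      exact Submodule.smul_top_le_comap_smul_top J (TensorProduct.mk R K N k) n.2
  · rw [Submodule.smul_le]
    intro a ha t _
    induction t with
    | zero => simp
    | add s t hs ht => rw [smul_add]; exact add_mem (hs trivial) (ht trivial)
    | tmul k n =>
      have : (J • ⊤ : Submodule R N).mkQ (a • n) = 0 := by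
        rw [Submodule.mkQ_apply, Submodule.Quotient.mk_eq_zero]
        exact Submodule.smul_mem_smul ha Submodule.mem_top
      rw [LinearMap.mem_ker, ← TensorProduct.tmul_smul, LinearMap.lTensor_tmul, this,
        TensorProduct.tmul_zero]

theorem IsLocalRing.maximalIdeal_mem_associatedPrimes_ker_rTensor_iff {R K F N ι : Type*}
    [CommRing R] [IsNoetherianRing R] [IsLocalRing R] [AddCommGroup K] [Module R K]
    [AddCommGroup F] [Module R F] [AddCommGroup N] [Module R N] [Finite ι] {s : ι → R}
    (hs : Ideal.span (Set.range s) = maximalIdeal R) (f : K →ₗ[R] F) (J : Ideal R) :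
    maximalIdeal R ∈
        associatedPrimes R (LinearMap.ker (f.rTensor (N ⧸ (J • ⊤ : Submodule R N)))) ↔
      ¬ (J • ⊤ : Submodule R (TensorProduct R F N × (ι → TensorProduct R K N))).comap
          ((f.rTensor N).prod (LinearMap.pi fun j ↦ LinearMap.lsmul R _ (s j))) ≤
        (J • ⊤ : Submodule R (TensorProduct R K N)) := by
  have hcomm (x : TensorProduct R K N) :
      f.rTensor _ ((J • ⊤ : Submodule R N).mkQ.lTensor K x) =
        (J • ⊤ : Submodule R N).mkQ.lTensor F (f.rTensor N x) := by
    rw [← LinearMap.comp_apply, ← LinearMap.comp_apply, LinearMap.rTensor_comp_lTensor,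
      LinearMap.lTensor_comp_rTensor]
  have hsocle (x : TensorProduct R K (N ⧸ (J • ⊤ : Submodule R N))) :
      (∀ a ∈ maximalIdeal R, a • x = 0) ↔ ∀ j, s j • x = 0 := by
    refine ⟨fun h j ↦ h _ (hs ▸ Ideal.subset_span ⟨j, rfl⟩), fun h ↦ ?_⟩
    have : maximalIdeal R ≤ LinearMap.ker (LinearMap.toSpanSingleton R _ x) := by
      rw [← hs, Ideal.span_le]
      rintro _ ⟨j, rfl⟩
      simpa using h j
    intro a ha
    simpa using this ha
  rw [maximalIdeal_mem_associatedPrimes_iff, SetLike.not_le_iff_exists]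
  simp only [Submodule.mem_comap, Submodule.mem_smul_top_prod, Submodule.mem_smul_top_pi,
    LinearMap.prod_apply, Function.prod, LinearMap.pi_apply, LinearMap.lsmul_apply,
    ← LinearMap.ker_lTensor_mkQ_smul_top, LinearMap.mem_ker, map_smul, ← hsocle, ← hcomm]
  constructor
  · rintro ⟨⟨y, hy⟩, hy0, hsy⟩
    obtain ⟨x, rfl⟩ := LinearMap.lTensor_surjective K (Submodule.mkQ_surjective _) y
    exact ⟨x, ⟨hy, fun a ha ↦ congrArg Subtype.val (hsy a ha)⟩, fun h ↦ hy0 (Subtype.ext h)⟩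
  · rintro ⟨x, ⟨hx, hsx⟩, hx0⟩
    exact ⟨⟨_, hx⟩, fun h ↦ hx0 (congrArg Subtype.val h), fun a ha ↦ Subtype.ext (hsx a ha)⟩

section Tor

open MonoidalCategory

theorem CategoryTheory.ProjectiveResolution.opcyclesMap_comp_fromLeftDerivedZero'
    {C D : Type*} [Category C] [Category D] [Abelian C] [Abelian D]
    [HasProjectiveResolutions C] {F G : C ⥤ D} [F.Additive] [G.Additive]
    (α : F ⟶ G) {X : C} (P : ProjectiveResolution X) :
    HomologicalComplex.opcyclesMap ((NatTrans.mapHomologicalComplex α _).app P.complex) 0 ≫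
      P.fromLeftDerivedZero' G = P.fromLeftDerivedZero' F ≫ α.app X := by
  rw [← cancel_epi (HomologicalComplex.pOpcycles _ _)]
  simp only [HomologicalComplex.p_opcyclesMap_assoc, NatTrans.mapHomologicalComplex_app_f,
    ProjectiveResolution.pOpcycles_comp_fromLeftDerivedZero',
    ProjectiveResolution.pOpcycles_comp_fromLeftDerivedZero'_assoc]
  exact (α.naturality (P.π.f 0)).symm

theorem CategoryTheory.ProjectiveResolution.exists_homology_zero_iso
    {C D : Type*} [Category C] [Category D] [Abelian C] [Abelian D]
    [HasProjectiveResolutions C] {F G : C ⥤ D} [F.Additive] [G.Additive]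
    [Limits.PreservesFiniteColimits F] [Limits.PreservesFiniteColimits G]
    (α : F ⟶ G) {X : C} (P : ProjectiveResolution X) :
    ∃ (e₁ : ((F.mapHomologicalComplex _).obj P.complex).homology 0 ≅ F.obj X)
      (e₂ : ((G.mapHomologicalComplex _).obj P.complex).homology 0 ≅ G.obj X),
      HomologicalComplex.homologyMap ((NatTrans.mapHomologicalComplex α _).app P.complex) 0 ≫
        e₂.hom = e₁.hom ≫ α.app X := by
  refine ⟨ChainComplex.isoHomologyι₀ _ ≪≫ asIso (P.fromLeftDerivedZero' F),
    ChainComplex.isoHomologyι₀ _ ≪≫ asIso (P.fromLeftDerivedZero' G), ?_⟩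
  simp [ProjectiveResolution.opcyclesMap_comp_fromLeftDerivedZero']

universe u
variable {R : Type u} [CommRing R]

/-- The complexes `Tⱼ ⊗ Q`, for `T` a short complex of modules and `Q` a chain complex. -/
noncomputable def tensorComplex (T : ShortComplex (ModuleCat.{u} R))
    (Q : ChainComplex (ModuleCat.{u} R) ℕ) : ShortComplex (ChainComplex (ModuleCat.{u} R) ℕ) where
  X₁ := (((tensoringLeft _).obj T.X₁).mapHomologicalComplex _).obj Q
  X₂ := (((tensoringLeft _).obj T.X₂).mapHomologicalComplex _).obj Q
  X₃ := (((tensoringLeft _).obj T.X₃).mapHomologicalComplex _).obj Q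
  f := (NatTrans.mapHomologicalComplex ((tensoringLeft _).map T.f) _).app Q
  g := (NatTrans.mapHomologicalComplex ((tensoringLeft _).map T.g) _).app Q
  zero := by
    ext1 i
    change T.f ▷ Q.X i ≫ T.g ▷ Q.X i = 0
    rw [← MonoidalCategory.comp_whiskerRight, T.zero, MonoidalPreadditive.zero_whiskerRight]

theorem tensorComplex_shortExact {T : ShortComplex (ModuleCat.{u} R)} (hT : T.ShortExact)
    (Q : ChainComplex (ModuleCat.{u} R) ℕ) [∀ i, Projective (Q.X i)] :
    (tensorComplex T Q).ShortExact := by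
  apply HomologicalComplex.shortExact_of_degreewise_shortExact
  intro i
  have : Module.Projective R (Q.X i) := by
    rw [IsProjective.iff_projective]; infer_instance
  exact hT.map_of_exact (tensorRight (Q.X i))

theorem isZero_homology_tensorComplex (T : ShortComplex (ModuleCat.{u} R)) [Module.Flat R T.X₂]
    {Y : ModuleCat.{u} R} (P : ProjectiveResolution Y) (n : ℕ) :
    Limits.IsZero ((tensorComplex T P.complex).X₂.homology (n + 1)) := by
  rw [← HomologicalComplex.exactAt_iff_isZero_homology]
  have := Module.Flat.lTensor_shortComplex_exact T.X₂ _
    ((HomologicalComplex.exactAt_iff _ _).mp (P.complex_exactAt_succ n))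
  rw [HomologicalComplex.exactAt_iff]
  exact this

/-- Dimension shifting for `Tor` along a short exact sequence with flat middle term. -/
noncomputable def torSuccIso {T : ShortComplex (ModuleCat.{u} R)} (hT : T.ShortExact)
    [Module.Flat R T.X₂] (Y : ModuleCat.{u} R) (n : ℕ) :
    ((Tor (ModuleCat R) (n + 2)).obj T.X₃).obj Y ≅ ((Tor (ModuleCat R) (n + 1)).obj T.X₁).obj Y :=
  (projectiveResolution Y).isoLeftDerivedObj _ _ ≪≫
    (tensorComplex_shortExact hT (projectiveResolution Y).complex).δIso (n + 2) (n + 1) rfl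
      (isZero_homology_tensorComplex T _ _) (isZero_homology_tensorComplex T _ _) ≪≫
    ((projectiveResolution Y).isoLeftDerivedObj _ _).symm

theorem nonempty_tor_one_equiv_ker {T : ShortComplex (ModuleCat.{u} R)} (hT : T.ShortExact)
    [Module.Flat R T.X₂] (Y : ModuleCat.{u} R) :
    Nonempty (((Tor (ModuleCat R) 1).obj T.X₃).obj Y ≃ₗ[R]
      LinearMap.ker (T.f.hom.rTensor Y)) := by
  let P := projectiveResolution Y
  have hS := tensorComplex_shortExact hT P.complex
  have hij : (ComplexShape.down ℕ).Rel 1 0 := rfl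
  have hmono : Mono (hS.δ 1 0 hij) := hS.mono_δ _ _ _ (isZero_homology_tensorComplex T P 0)
  have hex := hS.homology_exact₁ 1 0 hij
  obtain ⟨e₁, e₂, comm⟩ :
      ∃ (e₁ : (tensorComplex T P.complex).X₁.homology 0 ≅ T.X₁ ⊗ Y)
        (e₂ : (tensorComplex T P.complex).X₂.homology 0 ≅ T.X₂ ⊗ Y),
        HomologicalComplex.homologyMap (tensorComplex T P.complex).f 0 ≫ e₂.hom =
          e₁.hom ≫ T.f ▷ Y :=
    have (X : ModuleCat.{u} R) :
        Limits.PreservesFiniteColimits ((tensoringLeft (ModuleCat.{u} R)).obj X) :=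
      inferInstanceAs (Limits.PreservesFiniteColimits (tensorLeft X))
    ProjectiveResolution.exists_homology_zero_iso ((tensoringLeft _).map T.f) P
  obtain ⟨e⟩ : Nonempty (((Tor (ModuleCat R) 1).obj T.X₃).obj Y ≅
    (tensorComplex T P.complex).X₃.homology 1) := ⟨P.isoLeftDerivedObj _ _⟩
  have w : (e.hom ≫ hS.δ 1 0 hij ≫ e₁.hom) ≫ T.f ▷ Y = 0 := by
    simp only [Category.assoc]
    rw [← comm, hS.δ_comp_assoc]
    simp
  have hd : Mono (e.hom ≫ hS.δ 1 0 hij ≫ e₁.hom) := inferInstance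
  have hex' : (ShortComplex.mk _ (T.f ▷ Y) w).Exact :=
    ShortComplex.exact_of_iso (ShortComplex.isoMk e.symm e₁ e₂ (by simp) comm.symm) hex
  rw [ShortComplex.ShortExact.moduleCat_exact_iff_function_exact] at hex'
  rw [ModuleCat.mono_iff_injective] at hd
  exact ⟨(LinearEquiv.ofInjective _ hd).trans (LinearEquiv.ofEq _ _ hex'.linearMap_ker_eq.symm)⟩

theorem exists_tor_equiv_ker_rTensor (i : ℕ) (M : ModuleCat.{u} R) [IsNoetherianRing R]
    [Module.Finite R M] :
    ∃ (K F : ModuleCat.{u} R) (f : K →ₗ[R] F), Module.Finite R K ∧ Module.Finite R F ∧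
      ∀ Y : ModuleCat.{u} R, Nonempty (((Tor (ModuleCat R) i).obj M).obj Y ≃ₗ[R]
        LinearMap.ker (f.rTensor Y)) := by
  match i with
  | 0 =>
    refine ⟨M, M, 0, inferInstance, inferInstance, fun Y ↦ ?_⟩
    have : Limits.PreservesFiniteColimits ((tensoringLeft (ModuleCat.{u} R)).obj M) :=
      inferInstanceAs (Limits.PreservesFiniteColimits (tensorLeft M))
    have e : ((Tor (ModuleCat R) 0).obj M).obj Y ≅ M ⊗ Y :=
      ((tensoringLeft (ModuleCat R)).obj M).leftDerivedZeroIsoSelf.app Y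
    exact ⟨e.toLinearEquiv.trans
      (LinearEquiv.ofTop _ (by rw [LinearMap.rTensor_zero, LinearMap.ker_zero])).symm⟩
  | 1 =>
    obtain ⟨n, p, hp⟩ := Module.Finite.exists_fin' R M
    exact ⟨ModuleCat.of R (LinearMap.ker p), ModuleCat.of R (Fin n → R), (LinearMap.ker p).subtype,
      inferInstanceAs (Module.Finite R (LinearMap.ker p)),
      inferInstanceAs (Module.Finite R (Fin n → R)),
      have : Module.Flat R p.shortComplexKer.X₂ := inferInstanceAs (Module.Flat R (Fin n → R))
      nonempty_tor_one_equiv_ker (LinearMap.shortExact_shortComplexKer hp)⟩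
  | i + 2 =>
    obtain ⟨n, p, hp⟩ := Module.Finite.exists_fin' R M
    obtain ⟨K, F, f, hK, hF, e⟩ := exists_tor_equiv_ker_rTensor (i + 1) (.of R (LinearMap.ker p))
    have : Module.Flat R p.shortComplexKer.X₂ := inferInstanceAs (Module.Flat R (Fin n → R))
    exact ⟨K, F, f, hK, hF, fun Y ↦ (e Y).map
      (torSuccIso (LinearMap.shortExact_shortComplexKer hp) Y i).toLinearEquiv.trans⟩

end Tor

/-- Over a Noetherian local ring `(R, 𝔪)`, either `𝔪` is an associated prime of
`Tor_i^R(M, N/IⁿN)` for all sufficiently large `n`, or `𝔪` is not an associated prime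
of `Tor_i^R(M, N/IⁿN)` for any sufficiently large `n`. -/
theorem maximalIdeal_mem_ass_tor_dichotomy (R : Type) [CommRing R] [IsNoetherianRing R]
    [IsLocalRing R] (I : Ideal R) (M N : Type)
    [AddCommGroup M] [Module R M] [Module.Finite R M]
    [AddCommGroup N] [Module R N] [Module.Finite R N] (i : ℕ) :
    (∃ K : ℕ, ∀ n : ℕ, K ≤ n →
      IsLocalRing.maximalIdeal R ∈ associatedPrimes R
        (((Tor (ModuleCat R) i).obj (ModuleCat.of R M)).obj
          (ModuleCat.of R (N ⧸ (I ^ n • (⊤ : Submodule R N)))))) ∨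
    (∃ K : ℕ, ∀ n : ℕ, K ≤ n →
      IsLocalRing.maximalIdeal R ∉ associatedPrimes R
        (((Tor (ModuleCat R) i).obj (ModuleCat.of R M)).obj
          (ModuleCat.of R (N ⧸ (I ^ n • (⊤ : Submodule R N)))))) := by
  obtain ⟨K, F, f, hK, hF, e⟩ := exists_tor_equiv_ker_rTensor i (ModuleCat.of R M)
  obtain ⟨s, hs⟩ := (IsLocalRing.maximalIdeal R).fg_of_isNoetherianRing
  replace hs : Ideal.span (Set.range ((↑) : s → R)) = IsLocalRing.maximalIdeal R := by simpa using hs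
  have key (n : ℕ) :=
    (LinearEquiv.AssociatedPrimes.eq (e (.of R (N ⧸ (I ^ n • ⊤ : Submodule R N)))).some).symm ▸
      IsLocalRing.maximalIdeal_mem_associatedPrimes_ker_rTensor_iff (N := N) hs f (I ^ n)
  simp only [key, not_not]
  exact I.comap_pow_smul_top_dichotomy _
end

section
/- Let R be a commutative Noetherian ring, I an ideal, M a finitely generated R-module, and fix i ≥ 0. Then the set Ass_R(Tor_i^R(M, R/I^n)) is independent of n for all sufficiently large n. -/
open CategoryTheory

section AssociatedPrimes

variable {R M : Type*} [CommRing R] [AddCommGroup M] [Module R M]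

theorem mem_associatedPrimes_quotient_submoduleOf_iff [IsNoetherianRing R]
    {N L : Submodule R M} {p : Ideal R} :
    p ∈ associatedPrimes R (N ⧸ L.submoduleOf N) ↔
      p.IsPrime ∧ ∃ x ∈ N, ∀ r, r ∈ p ↔ r • x ∈ L := by
  rw [AssociatedPrimes.mem_iff, isAssociatedPrime_iff]
  refine and_congr_right fun _ ↦ ⟨?_, ?_⟩
  · rintro ⟨x, rfl⟩
    obtain ⟨⟨x, hx⟩, rfl⟩ := Submodule.mkQ_surjective _ x
    refine ⟨x, hx, fun r ↦ ?_⟩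
    rw [Submodule.mem_colon_singleton, ← map_smul, Submodule.mem_bot, Submodule.mkQ_apply,
      Submodule.Quotient.mk_eq_zero]
    rfl
  · rintro ⟨x, hx, h⟩
    refine ⟨Submodule.mkQ _ ⟨x, hx⟩, Ideal.ext fun r ↦ ?_⟩
    rw [h, Submodule.mem_colon_singleton, ← map_smul, Submodule.mem_bot, Submodule.mkQ_apply,
      Submodule.Quotient.mk_eq_zero]
    rfl

theorem injective_mapQ_submoduleOf_subtype (N L : Submodule R M) :
    Function.Injective (Submodule.mapQ (L.submoduleOf N) L N.subtype le_rfl) :=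
  LinearMap.ker_eq_bot.mp <| Submodule.ker_liftQ_eq_bot _ _ _ <| by
    simp [LinearMap.ker_comp, Submodule.submoduleOf]

theorem associatedPrimes_quotient_submoduleOf_subset (N L : Submodule R M) :
    associatedPrimes R (N ⧸ L.submoduleOf N) ⊆ associatedPrimes R (M ⧸ L) :=
  associatedPrimes.subset_of_injective (injective_mapQ_submoduleOf_subtype N L)

theorem associatedPrimes_quotient_subset_union {N L : Submodule R M} (h : L ≤ N) :
    associatedPrimes R (M ⧸ L) ⊆
      associatedPrimes R (N ⧸ L.submoduleOf N) ∪ associatedPrimes R (M ⧸ N) := by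
  refine associatedPrimes.subset_union_of_exact (g := Submodule.factor h)
    (injective_mapQ_submoduleOf_subtype N L) fun y ↦ ?_
  obtain ⟨y, rfl⟩ := Submodule.mkQ_surjective _ y
  constructor
  · intro hy
    exact ⟨Submodule.mkQ _ ⟨y, (Submodule.Quotient.mk_eq_zero _).mp hy⟩, rfl⟩
  · rintro ⟨z, hz⟩
    obtain ⟨z, rfl⟩ := Submodule.mkQ_surjective _ z
    rw [← hz]
    exact (Submodule.Quotient.mk_eq_zero _).mpr z.2

/-- The associated primes over `R` of `A ⧸ P`, for a prime `P` of an `R`-algebra `A`, reduce to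
the contraction of `P`. -/
theorem associatedPrimes_subset_of_linearEquiv_quotient_prime {A : Type*} [CommRing A]
    [Algebra R A] [Module A M] [IsScalarTower R A M] (P : PrimeSpectrum A)
    (e : M ≃ₗ[A] A ⧸ P.asIdeal) :
    associatedPrimes R M ⊆ {P.asIdeal.comap (algebraMap R A)} := by
  rintro p ⟨hp, x, hx⟩
  have hP := P.isPrime
  have hx0 : e x ≠ 0 := fun h ↦ by
    rw [map_eq_zero_iff _ e.injective] at h
    subst h
    exact hp.ne_top (by simp [hx])
  have h : Submodule.colon (⊥ : Submodule R M) {x} = P.asIdeal.comap (algebraMap R A) := by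
    ext r
    rw [Submodule.mem_colon_singleton, Submodule.mem_bot, Ideal.mem_comap,
      ← algebraMap_smul A r x, ← map_eq_zero_iff _ e.injective, map_smul, Algebra.smul_def,
      mul_eq_zero, or_iff_left hx0, Ideal.Quotient.algebraMap_eq, Ideal.Quotient.eq_zero_iff_mem]
  rw [Set.mem_singleton_iff, hx, h]
  exact (hP.comap _).radical

end AssociatedPrimes

/-- A finite module over a Noetherian `R`-algebra has finitely many associated primes over `R`. -/
theorem finite_associatedPrimes_of_isScalarTower (R : Type*) {A M : Type*} [CommRing R]
    [CommRing A] [Algebra R A] [IsNoetherianRing A] [AddCommGroup M] [Module A M] [Module R M]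
    [IsScalarTower R A M] [Module.Finite A M] : (associatedPrimes R M).Finite := by
  suffices H : ∀ [Module R M] [IsScalarTower R A M], (associatedPrimes R M).Finite from H
  induction ‹Module.Finite A M› using
    IsNoetherianRing.induction_on_isQuotientEquivQuotientPrime A with
  | subsingleton N => intros; simp [associatedPrimes.eq_empty_of_subsingleton]
  | quotient N P e =>
    intros
    exact (Set.finite_singleton _).subset
      (associatedPrimes_subset_of_linearEquiv_quotient_prime P e)
  | exact N₁ N₂ N₃ f g hf _ hfg h₁ h₃ =>
    intros
    let := Module.compHom N₁ (algebraMap R A)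
    let := Module.compHom N₃ (algebraMap R A)
    have : IsScalarTower R A N₁ := .of_algebraMap_smul fun _ _ ↦ rfl
    have : IsScalarTower R A N₃ := .of_algebraMap_smul fun _ _ ↦ rfl
    exact (h₁.union h₃).subset (associatedPrimes.subset_union_of_exact
      (f := f.restrictScalars R) (g := g.restrictScalars R) hf hfg)

/-- Variant of `finite_associatedPrimes_of_isScalarTower` for the quotient of `N` by `L`. -/
theorem finite_setOf_isPrime_and_exists_smul_mem_iff (R : Type*) {A M : Type*} [CommRing R]
    [IsNoetherianRing R] [CommRing A] [Algebra R A] [IsNoetherianRing A] [AddCommGroup M]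
    [Module A M] [Module R M] [IsScalarTower R A M] {N : Submodule A M} (hN : N.FG)
    (L : Submodule A M) :
    {p : Ideal R | p.IsPrime ∧ ∃ x ∈ N, ∀ r, r ∈ p ↔ r • x ∈ L}.Finite := by
  have : Module.Finite A N := Module.Finite.iff_fg.mpr hN
  refine (finite_associatedPrimes_of_isScalarTower R (A := A)
    (M := N ⧸ L.submoduleOf N)).subset fun p ⟨hp, h⟩ ↦ ?_
  exact mem_associatedPrimes_quotient_submoduleOf_iff (N := N.restrictScalars R)
    (L := L.restrictScalars R) |>.mpr ⟨hp, h⟩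

namespace Ideal.Filtration

variable {R M : Type*} [CommRing R] [IsNoetherianRing R] [AddCommGroup M] [Module R M]
  [Module.Finite R M] {I : Ideal R} {F F' : I.Filtration M}

omit [IsNoetherianRing R] [Module.Finite R M] in
theorem single_mem_submodule_iff {n : ℕ} {x : M} :
    PolynomialModule.single R n x ∈ F.submodule ↔ x ∈ F.N n := by
  refine ⟨fun hx ↦ by simpa using hx n, fun hx i ↦ ?_⟩
  rw [PolynomialModule.coeff_single, Finsupp.single_apply]
  split_ifs with hi
  · exact hi ▸ hx
  · exact zero_mem _

theorem Stable.finite_iUnion_associatedPrimes (hF : F.Stable) (F' : I.Filtration M) :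
    (⋃ n, associatedPrimes R (F.N n ⧸ (F'.N n).submoduleOf (F.N n))).Finite := by
  have hfg := (F.submodule_fg_iff_stable fun _ ↦ IsNoetherian.noetherian _).mpr hF
  refine (finite_setOf_isPrime_and_exists_smul_mem_iff R hfg F'.submodule).subset ?_
  refine Set.iUnion_subset fun n p hp ↦ ?_
  obtain ⟨hp, x, hx, h⟩ := mem_associatedPrimes_quotient_submoduleOf_iff.mp hp
  refine ⟨hp, PolynomialModule.single R n x, single_mem_submodule_iff.mpr hx, fun r ↦ ?_⟩
  rw [h, ← single_mem_submodule_iff, PolynomialModule.single_smul]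

/-- If `F' ≤ F` and `F` is stable, an element of `F.N n` multiplied by `I` into `F'.N (n + 1)`
lies in `F'.N n`, for `n` large. -/
theorem Stable.exists_forall_mem_of_smul_mem (hF : F.Stable) (hle : F' ≤ F) :
    ∃ c, ∀ n ≥ c, ∀ x ∈ F.N n, (∀ a ∈ I, a • x ∈ F'.N (n + 1)) → x ∈ F'.N n := by
  let H : I.Filtration M :=
    { N n := F.N n ⊓ ⨅ a ∈ I, (F'.N (n + 1)).comap (LinearMap.lsmul R M a)
      mono n := inf_le_inf (F.mono n) <|
        iInf₂_mono fun a _ ↦ Submodule.comap_mono (F'.mono (n + 1))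
      smul_le n := Submodule.smul_le.mpr fun a ha x hx ↦ by
        have hax : a • x ∈ F'.N (n + 1) := by
          have := hx.2
          simp only [Submodule.mem_iInf, SetLike.mem_coe] at this
          exact this a ha
        refine ⟨hle (n + 1) hax, ?_⟩
        simp only [Submodule.mem_iInf, SetLike.mem_coe]
        exact fun b hb ↦ F'.smul_le _ (Submodule.smul_mem_smul hb hax) }
  obtain ⟨c, hc⟩ := hF.of_le (F' := H) fun n ↦ inf_le_left
  refine ⟨c + 1, fun n hn x hx h ↦ ?_⟩
  obtain ⟨n, rfl⟩ := Nat.exists_eq_add_of_le' (Nat.one_le_of_lt hn)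
  have hxH : x ∈ H.N (n + 1) := by
    refine ⟨hx, ?_⟩
    simp only [Submodule.mem_iInf, SetLike.mem_coe]
    exact h
  rw [← hc n (Nat.le_of_succ_le_succ hn)] at hxH
  refine (Submodule.smul_le (P := F'.N (n + 1))).mpr (fun a ha y hy ↦ ?_) hxH
  have := hy.2
  simp only [Submodule.mem_iInf, SetLike.mem_coe] at this
  exact this a ha

/-- If `F' ≤ F` are `I`-filtrations with `F` stable, then the sets of associated primes of the
quotients `F.N n ⧸ F'.N n` are eventually increasing. -/
theorem Stable.exists_forall_associatedPrimes_subset_succ (hF : F.Stable) (hle : F' ≤ F) :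
    ∃ c, ∀ n ≥ c, associatedPrimes R (F.N n ⧸ (F'.N n).submoduleOf (F.N n)) ⊆
      associatedPrimes R (F.N (n + 1) ⧸ (F'.N (n + 1)).submoduleOf (F.N (n + 1))) := by
  obtain ⟨c, hc⟩ := hF.exists_forall_mem_of_smul_mem hle
  refine ⟨c, fun n hn p hp ↦ ?_⟩
  obtain ⟨hp, x, hx, h⟩ := mem_associatedPrimes_quotient_submoduleOf_iff.mp hp
  obtain ⟨s, hs⟩ := IsNoetherian.noetherian I
  have hsI (a : R) (ha : a ∈ s) : a ∈ I := hs ▸ Submodule.subset_span ha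
  have hinf : s.inf (fun a ↦ (F'.N (n + 1)).comap (LinearMap.toSpanSingleton R M (a • x))) ≤ p := by
    intro r hr
    rw [Submodule.mem_finsetInf] at hr
    refine (h r).mpr (hc n hn _ (Submodule.smul_mem _ _ hx) fun a ha ↦ ?_)
    suffices I ≤ (F'.N (n + 1)).comap (LinearMap.toSpanSingleton R M (r • x)) from this ha
    refine hs.ge.trans (Submodule.span_le.mpr fun a ha ↦ ?_)
    simpa [smul_comm a r x] using hr a ha
  obtain ⟨a, ha, hap⟩ := (Ideal.IsPrime.inf_le' hp).mp hinf
  refine mem_associatedPrimes_quotient_submoduleOf_iff.mpr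
    ⟨hp, a • x, F.smul_le n (Submodule.smul_mem_smul (hsI a ha) hx), fun r ↦ ⟨fun hr ↦ ?_, ?_⟩⟩
  · rw [smul_comm]
    exact F'.smul_le n (Submodule.smul_mem_smul (hsI a ha) ((h r).mp hr))
  · exact fun hr ↦ hap hr

end Ideal.Filtration

theorem exists_forall_ge_eq_of_subset_succ {α : Type*} {s : ℕ → Set α} {c : ℕ}
    (hmono : ∀ n ≥ c, s n ⊆ s (n + 1)) (hfin : (⋃ n, s n).Finite) :
    ∃ K, ∀ n ≥ K, s n = s K := by
  have hle (n : ℕ) : s (c + n) ⊆ s (c + (n + 1)) := hmono _ (Nat.le_add_right c n)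
  let f : ℕ →o Set (⋃ n, s n) := ⟨fun n ↦ Subtype.val ⁻¹' s (c + n),
    monotone_nat_of_le_succ fun n ↦ Set.preimage_mono (hle n)⟩
  have := hfin.to_subtype
  obtain ⟨m, hm⟩ := WellFoundedGT.monotone_chain_condition f
  refine ⟨c + m, fun n hn ↦ ?_⟩
  obtain ⟨k, rfl⟩ := Nat.exists_eq_add_of_le hn
  have h := hm (m + k) (Nat.le_add_right m k)
  rw [add_assoc]
  exact ((Set.preimage_eq_preimage' (s := s (c + m)) (t := s (c + (m + k)))
    (f := (Subtype.val : (⋃ n, s n : Set α) → α))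
    (Subtype.range_coe.symm ▸ Set.subset_iUnion s _)
    (Subtype.range_coe.symm ▸ Set.subset_iUnion s _)).mp h).symm

theorem exists_forall_ge_eq_of_succ_subset {α : Type*} {s : ℕ → Set α} {c : ℕ}
    (hanti : ∀ n ≥ c, s (n + 1) ⊆ s n) (hfin : (s c).Finite) :
    ∃ K, ∀ n ≥ K, s n = s K := by
  have hle (n : ℕ) (hn : c ≤ n) : s n ⊆ s c := by
    induction n, hn using Nat.le_induction with
    | base => rfl
    | succ n hn ih => exact (hanti n hn).trans ih
  obtain ⟨K, hK⟩ := exists_forall_ge_eq_of_subset_succ (s := fun n ↦ s c \ s n) (c := c)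
    (fun n hn ↦ Set.sdiff_subset_sdiff_right (hanti n hn))
    (hfin.subset (Set.iUnion_subset fun n ↦ Set.sdiff_subset))
  refine ⟨c + K, fun n hn ↦ ?_⟩
  rw [← Set.sdiff_sdiff_cancel_left (hle n (by lia)),
    ← Set.sdiff_sdiff_cancel_left (hle (c + K) (by lia)), hK n (by lia), hK (c + K) (by lia)]

theorem Ideal.Filtration.Stable.exists_forall_associatedPrimes_eq
    {R M : Type*} [CommRing R] [IsNoetherianRing R] [AddCommGroup M] [Module R M]
    [Module.Finite R M] {I : Ideal R} {F F' : I.Filtration M} (hF : F.Stable) (hle : F' ≤ F) :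
    ∃ K, ∀ n ≥ K, associatedPrimes R (F.N n ⧸ (F'.N n).submoduleOf (F.N n)) =
      associatedPrimes R (F.N K ⧸ (F'.N K).submoduleOf (F.N K)) := by
  obtain ⟨c, hc⟩ := hF.exists_forall_associatedPrimes_subset_succ hle
  exact exists_forall_ge_eq_of_subset_succ hc (hF.finite_iUnion_associatedPrimes F')

section Brodmann

variable {R M : Type*} [CommRing R] [IsNoetherianRing R] [AddCommGroup M] [Module R M]
  [Module.Finite R M] (I : Ideal R)

/-- **Brodmann's theorem**: the sets of associated primes of `M ⧸ Iⁿ M` are eventually constant. -/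
theorem exists_forall_associatedPrimes_quotient_pow_smul_top_eq :
    ∃ K, ∀ n ≥ K, associatedPrimes R (M ⧸ (I ^ n • ⊤ : Submodule R M)) =
      associatedPrimes R (M ⧸ (I ^ K • ⊤ : Submodule R M)) := by
  let F := I.stableFiltration (⊤ : Submodule R M)
  let F' : I.Filtration M :=
    { N n := F.N (n + 1), mono n := F.mono (n + 1), smul_le n := F.smul_le (n + 1) }
  have hle : F' ≤ F := F.mono
  obtain ⟨K, hK⟩ := (I.stableFiltration_stable ⊤).exists_forall_associatedPrimes_eq hle
  refine exists_forall_ge_eq_of_succ_subset (c := K + 1) (fun n hn ↦ ?_)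
    (associatedPrimes.finite R _)
  obtain ⟨n, rfl⟩ := Nat.exists_eq_add_of_le' (Nat.one_le_of_lt hn)
  intro p hp
  by_cases hpn : p ∈ associatedPrimes R (F.N n ⧸ (F'.N n).submoduleOf (F.N n))
  · exact associatedPrimes_quotient_submoduleOf_subset _ _ hpn
  rw [hK n (by lia), ← hK (n + 1) (by lia)] at hpn
  exact (associatedPrimes_quotient_subset_union (F.mono (n + 1)) hp).resolve_left hpn

/-- For `N ≤ M`, the sets of associated primes of `(N ⊓ Iⁿ M) ⧸ Iⁿ N` are eventually constant. -/
theorem exists_forall_associatedPrimes_inf_pow_smul_top_eq (N : Submodule R M) :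
    ∃ K, ∀ n ≥ K,
      associatedPrimes R (↥(I ^ n • ⊤ ⊓ N) ⧸ (I ^ n • N).submoduleOf (I ^ n • ⊤ ⊓ N)) =
        associatedPrimes R (↥(I ^ K • ⊤ ⊓ N) ⧸ (I ^ K • N).submoduleOf (I ^ K • ⊤ ⊓ N)) :=
  ((I.stableFiltration_stable ⊤).inter_right
    (I.trivialFiltration N)).exists_forall_associatedPrimes_eq (F' := I.stableFiltration N)
    fun _ ↦ le_inf (smul_mono_right _ le_top) Submodule.smul_le_right

end Brodmann

namespace CategoryTheory.ProjectiveResolution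

open Limits

variable {C D : Type*} [Category* C] [Category* D] [Abelian C] [Abelian D]
  {F₁ F₂ F₃ : C ⥤ D} [F₁.Additive] [F₂.Additive] [F₃.Additive]

/-- Two composable natural transformations with zero composite, evaluated at a projective
resolution. -/
noncomputable def mapShortComplex (α : F₁ ⟶ F₂) (β : F₂ ⟶ F₃) (w : α ≫ β = 0) {X : C}
    (P : ProjectiveResolution X) : ShortComplex (ChainComplex D ℕ) where
  X₁ := (F₁.mapHomologicalComplex _).obj P.complex
  X₂ := (F₂.mapHomologicalComplex _).obj P.complex
  X₃ := (F₃.mapHomologicalComplex _).obj P.complex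
  f := (NatTrans.mapHomologicalComplex α _).app P.complex
  g := (NatTrans.mapHomologicalComplex β _).app P.complex
  zero := by
    ext i : 1
    exact congr_app w (P.complex.X i)

theorem shortExact_mapShortComplex (α : F₁ ⟶ F₂) (β : F₂ ⟶ F₃) (w : α ≫ β = 0)
    (h : ∀ (Q : C) [Projective Q],
      (ShortComplex.mk (α.app Q) (β.app Q) (congr_app w Q)).ShortExact)
    {X : C} (P : ProjectiveResolution X) : (P.mapShortComplex α β w).ShortExact :=
  HomologicalComplex.shortExact_of_degreewise_shortExact _ fun i ↦ h (P.complex.X i)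

theorem isZero_homology_succ_of_preservesHomology (F : C ⥤ D) [F.Additive]
    [F.PreservesHomology] {X : C} (P : ProjectiveResolution X) (n : ℕ) :
    IsZero (((F.mapHomologicalComplex _).obj P.complex).homology (n + 1)) := by
  rw [← HomologicalComplex.exactAt_iff_isZero_homology]
  exact ShortComplex.Exact.map (P.complex_exactAt_succ n) F

theorem fromLeftDerivedZero'_naturality_functor (α : F₁ ⟶ F₂) {X : C}
    (P : ProjectiveResolution X) :
    HomologicalComplex.opcyclesMap ((NatTrans.mapHomologicalComplex α _).app P.complex) 0 ≫
      P.fromLeftDerivedZero' F₂ = P.fromLeftDerivedZero' F₁ ≫ α.app X := by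
  rw [← cancel_epi (HomologicalComplex.pOpcycles _ _), HomologicalComplex.p_opcyclesMap_assoc,
    pOpcycles_comp_fromLeftDerivedZero', pOpcycles_comp_fromLeftDerivedZero'_assoc]
  exact (α.naturality _).symm

/-- For a right exact functor `F`, the homology in degree `0` of `F` applied to a projective
resolution of `X` is `F.obj X`. -/
noncomputable def homologyZeroIso (F : C ⥤ D) [F.Additive] [PreservesFiniteColimits F] {X : C}
    (P : ProjectiveResolution X) :
    ((F.mapHomologicalComplex _).obj P.complex).homology 0 ≅ F.obj X :=
  ChainComplex.isoHomologyι₀ _ ≪≫ asIso (P.fromLeftDerivedZero' F)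

theorem homologyZeroIso_hom_naturality [PreservesFiniteColimits F₁] [PreservesFiniteColimits F₂]
    (α : F₁ ⟶ F₂) {X : C} (P : ProjectiveResolution X) :
    HomologicalComplex.homologyMap ((NatTrans.mapHomologicalComplex α _).app P.complex) 0 ≫
      (P.homologyZeroIso F₂).hom = (P.homologyZeroIso F₁).hom ≫ α.app X := by
  change _ ≫ HomologicalComplex.homologyι _ 0 ≫ _ = (HomologicalComplex.homologyι _ 0 ≫ _) ≫ _
  rw [HomologicalComplex.homologyι_naturality_assoc, asIso_hom, asIso_hom,
    fromLeftDerivedZero'_naturality_functor, Category.assoc]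

theorem exists_exact_homology_one_zero (α : F₁ ⟶ F₂) (β : F₂ ⟶ F₃) (w : α ≫ β = 0)
    (h : ∀ (Q : C) [Projective Q],
      (ShortComplex.mk (α.app Q) (β.app Q) (congr_app w Q)).ShortExact)
    [F₂.PreservesHomology] {X : C} (P : ProjectiveResolution X) :
    ∃ (d : ((F₃.mapHomologicalComplex _).obj P.complex).homology 1 ⟶
        ((F₁.mapHomologicalComplex _).obj P.complex).homology 0)
      (hd : d ≫ HomologicalComplex.homologyMap
        ((NatTrans.mapHomologicalComplex α _).app P.complex) 0 = 0),
      Mono d ∧ (ShortComplex.mk d _ hd).Exact :=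
  have hT := P.shortExact_mapShortComplex α β w h
  ⟨hT.δ 1 0 (by simp), hT.δ_comp 1 0 (by simp),
    hT.mono_δ 1 0 (by simp) (P.isZero_homology_succ_of_preservesHomology F₂ 0),
    hT.homology_exact₁ 1 0 (by simp)⟩

end CategoryTheory.ProjectiveResolution

namespace CategoryTheory.Functor

open Limits

variable {C D : Type*} [Category* C] [Category* D] [Abelian C] [Abelian D]
  [HasProjectiveResolutions C]
  {F₁ F₂ F₃ : C ⥤ D} [F₁.Additive] [F₂.Additive] [F₃.Additive]

/-- Dimension shifting: if `F₁ ⟶ F₂ ⟶ F₃` is short exact on projective objects and `F₂` is exact,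
then the left derived functors of `F₃` are those of `F₁` in one degree less, from degree `2` on. -/
theorem nonempty_leftDerived_succ_succ_iso (α : F₁ ⟶ F₂) (β : F₂ ⟶ F₃) (w : α ≫ β = 0)
    (h : ∀ (Q : C) [Projective Q],
      (ShortComplex.mk (α.app Q) (β.app Q) (congr_app w Q)).ShortExact)
    [F₂.PreservesHomology] (X : C) (n : ℕ) :
    Nonempty ((F₃.leftDerived (n + 2)).obj X ≅ (F₁.leftDerived (n + 1)).obj X) :=
  let P := projectiveResolution X
  ⟨P.isoLeftDerivedObj F₃ (n + 2) ≪≫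
    (P.shortExact_mapShortComplex α β w h).δIso (n + 2) (n + 1) rfl
      (P.isZero_homology_succ_of_preservesHomology F₂ _)
      (P.isZero_homology_succ_of_preservesHomology F₂ _) ≪≫
    (P.isoLeftDerivedObj F₁ (n + 1)).symm⟩

/-- If `F₁ ⟶ F₂ ⟶ F₃` is short exact on projective objects, `F₁` is right exact and `F₂` is exact,
then the first left derived functor of `F₃` is the kernel of `F₁ ⟶ F₂`. -/
theorem exists_exact_leftDerived_one (α : F₁ ⟶ F₂) (β : F₂ ⟶ F₃) (w : α ≫ β = 0)
    (h : ∀ (Q : C) [Projective Q],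
      (ShortComplex.mk (α.app Q) (β.app Q) (congr_app w Q)).ShortExact)
    [F₂.PreservesHomology] [PreservesFiniteColimits F₁] [PreservesFiniteColimits F₂] (X : C) :
    ∃ (δ : (F₃.leftDerived 1).obj X ⟶ F₁.obj X) (hδ : δ ≫ α.app X = 0),
      Mono δ ∧ (ShortComplex.mk δ (α.app X) hδ).Exact := by
  let P := projectiveResolution X
  obtain ⟨d, hd, hmono, hex⟩ := P.exists_exact_homology_one_zero α β w h
  have hnat := P.homologyZeroIso_hom_naturality α
  let e : (F₃.leftDerived 1).obj X ≅ ((F₃.mapHomologicalComplex _).obj P.complex).homology 1 :=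
    P.isoLeftDerivedObj F₃ 1
  let δ := e.hom ≫ d ≫ (P.homologyZeroIso F₁).hom
  have hδ : δ ≫ α.app X = 0 := by simp [δ, ← hnat, reassoc_of% hd]
  exact ⟨δ, hδ, inferInstance, (ShortComplex.exact_iff_of_iso (ShortComplex.isoMk e.symm
    (P.homologyZeroIso F₁) (P.homologyZeroIso F₂) (by simp [δ]) hnat.symm)).mp hex⟩

end CategoryTheory.Functor

section TensorQuotient

open TensorProduct

variable {R M : Type*} [CommRing R] [AddCommGroup M] [Module R M]

theorem TensorProduct.tmul_one_quotient_eq_zero_iff (I : Ideal R) (x : M) :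
    x ⊗ₜ[R] (1 : R ⧸ I) = 0 ↔ x ∈ (I • ⊤ : Submodule R M) := by
  rw [← tensorQuotEquivQuotSMul_symm_mk, LinearEquiv.map_eq_zero_iff,
    Submodule.Quotient.mk_eq_zero]

theorem Submodule.nonempty_ker_rTensor_quotient_equiv (I : Ideal R) (N : Submodule R M) :
    Nonempty (LinearMap.ker (N.subtype.rTensor (R ⧸ I)) ≃ₗ[R]
      ↥(I • ⊤ ⊓ N) ⧸ (I • N).submoduleOf (I • ⊤ ⊓ N)) := by
  let φ : ↥(I • ⊤ ⊓ N) →ₗ[R] N ⊗[R] (R ⧸ I) :=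
    (TensorProduct.mk R N (R ⧸ I)).flip 1 ∘ₗ inclusion inf_le_right
  have hker : LinearMap.ker φ = (I • N).submoduleOf (I • ⊤ ⊓ N) := by
    ext x
    have hN : I • N = (I • ⊤ : Submodule R N).map N.subtype := by
      rw [map_smul'', map_subtype_top]
    rw [hN, LinearMap.mem_ker]
    refine (tmul_one_quotient_eq_zero_iff I (inclusion inf_le_right x)).trans
      (N.subtype_injective.mem_set_image (s := (I • ⊤ : Submodule R N))).symm
  have hrange : LinearMap.range φ = LinearMap.ker (N.subtype.rTensor (R ⧸ I)) := by
    ext z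
    obtain ⟨y, rfl⟩ := (tensorQuotEquivQuotSMul N I).symm.surjective z
    obtain ⟨x, rfl⟩ := mkQ_surjective _ y
    rw [mkQ_apply, tensorQuotEquivQuotSMul_symm_mk, LinearMap.mem_ker]
    refine ⟨?_, fun hx ↦ ⟨⟨x, (tmul_one_quotient_eq_zero_iff I _).mp hx, x.2⟩, rfl⟩⟩
    rintro ⟨w, hw⟩
    rw [← hw]
    exact (tmul_one_quotient_eq_zero_iff I (w : M)).mpr w.2.1
  exact ⟨LinearEquiv.ofEq _ _ hrange.symm ≪≫ₗ φ.quotKerEquivRange.symm ≪≫ₗ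
    quotEquivOfEq _ _ hker⟩

end TensorQuotient

section Tor

open MonoidalCategory

universe u

variable {R : Type u} [CommRing R]

namespace CategoryTheory.ShortComplex.ShortExact

variable {S : ShortComplex (ModuleCat.{u} R)}

theorem map_tensorRight_of_projective (hS : S.ShortExact) (Q : ModuleCat.{u} R)
    [Projective Q] : (S.map (tensorRight Q)).ShortExact :=
  have : Module.Projective R Q := (IsProjective.iff_projective Q).mpr ‹_›
  hS.map_of_exact (tensorRight Q)

theorem nonempty_Tor_succ_succ_iso (hS : S.ShortExact) [Module.Flat R S.X₂]
    (Y : ModuleCat.{u} R) (n : ℕ) :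
    Nonempty (((Tor (ModuleCat.{u} R) (n + 2)).obj S.X₃).obj Y ≅
      ((Tor (ModuleCat.{u} R) (n + 1)).obj S.X₁).obj Y) :=
  Functor.nonempty_leftDerived_succ_succ_iso ((tensoringLeft _).map S.f)
    ((tensoringLeft _).map S.g) (by rw [← Functor.map_comp, S.zero, Functor.map_zero])
    (fun Q _ ↦ hS.map_tensorRight_of_projective Q) Y n

theorem nonempty_Tor_one_equiv (hS : S.ShortExact) [Module.Flat R S.X₂]
    (Y : ModuleCat.{u} R) :
    Nonempty (((Tor (ModuleCat.{u} R) 1).obj S.X₃).obj Y ≃ₗ[R]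
      LinearMap.ker (S.f.hom.rTensor Y)) := by
  obtain ⟨δ, hδ, hmono, hex⟩ := Functor.exists_exact_leftDerived_one ((tensoringLeft _).map S.f)
    ((tensoringLeft _).map S.g) (by rw [← Functor.map_comp, S.zero, Functor.map_zero])
    (fun Q _ ↦ hS.map_tensorRight_of_projective Q) Y
  have hinj := (ModuleCat.mono_iff_injective δ).mp hmono
  have hker := ((moduleCat_exact_iff_function_exact _).mp hex).linearMap_ker_eq
  exact ⟨LinearEquiv.ofInjective δ.hom hinj ≪≫ₗ LinearEquiv.ofEq _ _ hker.symm⟩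

end CategoryTheory.ShortComplex.ShortExact

/-- For a surjection `f : F → M` with `F` flat and kernel `N`, the module `Tor₁(M, R ⧸ I)` is
`(I F ⊓ N) ⧸ I N`. -/
theorem LinearMap.nonempty_Tor_one_quotient_equiv {F M : Type u} [AddCommGroup F] [Module R F]
    [AddCommGroup M] [Module R M] [Module.Flat R F] {f : F →ₗ[R] M} (hf : Function.Surjective f)
    (I : Ideal R) :
    Nonempty (((Tor (ModuleCat.{u} R) 1).obj (ModuleCat.of R M)).obj (ModuleCat.of R (R ⧸ I)) ≃ₗ[R]
      ↥(I • ⊤ ⊓ ker f) ⧸ (I • ker f).submoduleOf (I • ⊤ ⊓ ker f)) := by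
  have : Module.Flat R f.shortComplexKer.X₂ := ‹Module.Flat R F›
  have e : Nonempty (((Tor (ModuleCat.{u} R) 1).obj (ModuleCat.of R M)).obj
      (ModuleCat.of R (R ⧸ I)) ≃ₗ[R] ker ((ker f).subtype.rTensor (R ⧸ I))) :=
    (shortExact_shortComplexKer hf).nonempty_Tor_one_equiv (ModuleCat.of R (R ⧸ I))
  exact ⟨e.some ≪≫ₗ (Submodule.nonempty_ker_rTensor_quotient_equiv I (ker f)).some⟩

theorem ModuleCat.nonempty_Tor_zero_equiv (M Y : ModuleCat.{u} R) :
    Nonempty (((Tor (ModuleCat.{u} R) 0).obj M).obj Y ≃ₗ[R] TensorProduct R M Y) :=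
  ⟨(((tensoringLeft _).obj M).leftDerivedZeroIsoSelf.app Y).toLinearEquiv⟩

end Tor

/-- **Melkersson–Schenzel theorem.** For a finitely generated module `M` over a
commutative Noetherian ring `R`, an ideal `I` and fixed `i`, the set of associated
primes of `Tor_i^R(M, R/Iⁿ)` is independent of `n` for all sufficiently large `n`. -/
theorem melkersson_schenzel (R : Type) [CommRing R] [IsNoetherianRing R]
    (I : Ideal R) (M : Type) [AddCommGroup M] [Module R M] [Module.Finite R M]
    (i : ℕ) :
    ∃ K : ℕ, ∀ n : ℕ, K ≤ n →
      associatedPrimes R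
        (((Tor (ModuleCat R) i).obj (ModuleCat.of R M)).obj
          (ModuleCat.of R (R ⧸ (I ^ n)))) =
      associatedPrimes R
        (((Tor (ModuleCat R) i).obj (ModuleCat.of R M)).obj
          (ModuleCat.of R (R ⧸ (I ^ K)))) := by
  induction i generalizing M with
  | zero =>
    obtain ⟨K, hK⟩ := exists_forall_associatedPrimes_quotient_pow_smul_top_eq (M := M) I
    have key (n : ℕ) := LinearEquiv.AssociatedPrimes.eq
      (((ModuleCat.of R M).nonempty_Tor_zero_equiv (ModuleCat.of R (R ⧸ I ^ n))).some ≪≫ₗ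
        TensorProduct.tensorQuotEquivQuotSMul M (I ^ n))
    exact ⟨K, fun n hn ↦ by rw [key n, key K, hK n hn]⟩
  | succ i ih =>
    obtain ⟨m, f, hf⟩ := Module.Finite.exists_fin' R M
    have hS := LinearMap.shortExact_shortComplexKer hf
    have : Module.Flat R f.shortComplexKer.X₂ := inferInstanceAs (Module.Flat R (Fin m → R))
    cases i with
    | zero =>
      obtain ⟨K, hK⟩ := exists_forall_associatedPrimes_inf_pow_smul_top_eq I (LinearMap.ker f)
      have key (n : ℕ) := LinearEquiv.AssociatedPrimes.eq
        (LinearMap.nonempty_Tor_one_quotient_equiv hf (I ^ n)).some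
      exact ⟨K, fun n hn ↦ (key n).trans ((hK n hn).trans (key K).symm)⟩
    | succ i =>
      obtain ⟨K, hK⟩ := ih (LinearMap.ker f)
      have key (n : ℕ) := LinearEquiv.AssociatedPrimes.eq
        (hS.nonempty_Tor_succ_succ_iso (ModuleCat.of R (R ⧸ I ^ n)) i).some.toLinearEquiv
      exact ⟨K, fun n hn ↦ (key n).trans ((hK n hn).trans (key K).symm)⟩
end
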